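/- Let (Δ,δ) be a building of type (W,S) where W satisfies the nested condition relative to u ∈ S. Let C, D, E ∈ Δ and let φ, φ₁, φ₂ : W → Δ be isometries with φ(1) = D = φ₁(1), φ(w) = C, φ₁(w₁) = E, φ₂(1) = C, and φ₂(w₂) = E, for elements w, w₁, w₂ ∈ W. If there exist signs †, †' ∈ {+, −} such that w·H_u^† ⊊ H_u^- and H_u^- ⊊ w₁·H_u^{†'}, then H_u^† ⊊ w₂·H_u^{†'}. -/

import Mathlib

open Pointwise
open scoped Classical

variable {B : Type*} {W : Type*} [Group W] {M : CoxeterMatrix B}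

/-- The positive root `H_s^+` associated to the generator indexed by `i`:
elements `g` with `l(sg) > l(g)`. -/
def Hp (cs : CoxeterSystem M W) (i : B) : Set W :=
  {g : W | cs.length g < cs.length (cs.simple i * g)}

/-- The negative root `H_s^-`: elements `g` with `l(sg) < l(g)`. -/
def Hm (cs : CoxeterSystem M W) (i : B) : Set W :=
  {g : W | cs.length (cs.simple i * g) < cs.length g}

/-- `g` satisfies one of the six cases of the nested condition relative to `s`. -/
def NestedAt (cs : CoxeterSystem M W) (i : B) (g : W) : Prop :=
  g • Hp cs i = Hp cs i ∨ g • Hp cs i = Hm cs i ∨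
  g • Hp cs i ⊂ Hp cs i ∨ g • Hp cs i ⊂ Hm cs i ∨
  g • Hm cs i ⊂ Hp cs i ∨ g • Hm cs i ⊂ Hm cs i

/-- `W` satisfies the nested condition relative to the generator indexed by `i`. -/
def Nested (cs : CoxeterSystem M W) (i : B) : Prop := ∀ g : W, NestedAt cs i g

/-- The stabilizer `Stab_{H_s^+}` of the positive root. -/
def StabHp (cs : CoxeterSystem M W) (i : B) : Set W :=
  {g : W | g • Hp cs i = Hp cs i}

/-- The multiplier `m_W^s`. -/
noncomputable def mWs (cs : CoxeterSystem M W) (i : B) (g : W) : ℤ :=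
  if g ∈ Hp cs i then 1 else -1

/-- `(Δ, d)` is a building of type `(W,S)`: axioms (B1), (B2), (B3). -/
def IsBuilding (cs : CoxeterSystem M W) (Δ : Type*) (d : Δ → Δ → W) : Prop :=
  Nonempty Δ ∧
  (∀ C D : Δ, d C D = 1 ↔ C = D) ∧
  (∀ (C D E : Δ) (i : B), d E C = cs.simple i →
    (d E D = cs.simple i * d C D ∨ d E D = d C D) ∧
    (cs.length (d C D) < cs.length (cs.simple i * d C D) → d E D = cs.simple i * d C D)) ∧
  (∀ (C D : Δ) (i : B), ∃ E : Δ, d E C = cs.simple i ∧ d E D = cs.simple i * d C D)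

/-- `φ : W → Δ` is an isometry into the building. -/
def IsIsom {Δ : Type*} (d : Δ → Δ → W) (φ : W → Δ) : Prop :=
  ∀ a b : W, d (φ a) (φ b) = a⁻¹ * b

namespace CoxeterSystem

/-- The involution of `W × ZMod 2` attached to a simple reflection: it conjugates the first
coordinate, and flips the sign when the first coordinate is that simple reflection. -/
noncomputable def signedConj (cs : CoxeterSystem M W) (i : B) : Equiv.Perm (W × ZMod 2) :=
  Function.Involutive.toPerm
    (fun p => (cs.simple i * p.1 * cs.simple i, p.2 + if p.1 = cs.simple i then 1 else 0)) (by
      rintro ⟨t, e⟩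
      have h : cs.simple i * t * cs.simple i = cs.simple i ↔ t = cs.simple i := by
        constructor
        · intro h
          have := congrArg (fun x => cs.simple i * x * cs.simple i) h
          simpa [mul_assoc] using this
        · rintro rfl; simp
      ext1
      · simp [mul_assoc]
      · simp only [h]
        split_ifs
        · rw [add_assoc, CharTwo.add_self_eq_zero, add_zero]
        · simp)

theorem signedConj_apply (cs : CoxeterSystem M W) (i : B) (t : W) (e : ZMod 2) :
    cs.signedConj i (t, e) =
      (cs.simple i * t * cs.simple i, e + if t = cs.simple i then 1 else 0) := rfl

theorem simple_mul_pow_mul_simple (cs : CoxeterSystem M W) (i j : B) (k : ℕ) :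
    cs.simple j * (cs.simple i * cs.simple j) ^ k * cs.simple j =
      ((cs.simple i * cs.simple j) ^ k)⁻¹ := by
  have h := conj_pow (i := k) (a := cs.simple j) (b := cs.simple i * cs.simple j)
  rw [cs.inv_simple] at h
  rw [← h, ← inv_pow]
  simp [mul_assoc]

theorem signedConj_mul_pow_apply (cs : CoxeterSystem M W) (i j : B) (k : ℕ) (t : W) (e : ZMod 2) :
    ((cs.signedConj i * cs.signedConj j) ^ k) (t, e) =
      ((cs.simple i * cs.simple j) ^ k * t * ((cs.simple i * cs.simple j) ^ k)⁻¹,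
        e + ∑ n ∈ Finset.range (2 * k),
          if t = cs.simple j * (cs.simple i * cs.simple j) ^ n then 1 else 0) := by
  induction k with
  | zero => simp
  | succ k ih =>
    rw [pow_succ', Equiv.Perm.mul_apply, ih, Equiv.Perm.mul_apply, signedConj_apply,
      signedConj_apply]
    set p := cs.simple i * cs.simple j with hp
    have hj := cs.simple_mul_pow_mul_simple i j k
    rw [← hp] at hj
    have hjj : cs.simple j * cs.simple j = 1 := cs.simple_mul_simple_self j
    have hpj : (p ^ k)⁻¹ * cs.simple j = cs.simple j * p ^ k := by
      rw [← hj, mul_assoc, hjj, mul_one]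
    have h1 : p ^ k * t * (p ^ k)⁻¹ = cs.simple j ↔ t = cs.simple j * p ^ (2 * k) := by
      rw [mul_inv_eq_iff_eq_mul, ← eq_inv_mul_iff_mul_eq, ← mul_assoc, hpj, mul_assoc, ← pow_add,
        two_mul]
    have h2 : cs.simple j * (p ^ k * t * (p ^ k)⁻¹) * cs.simple j = cs.simple i ↔
        t = cs.simple j * p ^ (2 * k + 1) := by
      have : cs.simple j * (p ^ k * t * (p ^ k)⁻¹) * cs.simple j = cs.simple i ↔
          p ^ k * t * (p ^ k)⁻¹ = cs.simple j * p := by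
        rw [← eq_mul_inv_iff_mul_eq, ← eq_inv_mul_iff_mul_eq, cs.inv_simple, hp]
      rw [this, mul_inv_eq_iff_eq_mul, ← eq_inv_mul_iff_mul_eq, mul_assoc, ← mul_assoc, hpj,
        ← pow_succ', mul_assoc, ← pow_add]
      congr! 3
      omega
    ext1
    · simp only [pow_succ', mul_inv_rev, hp, cs.inv_simple, mul_assoc]
    · simp only [h1, h2]
      rw [show 2 * (k + 1) = 2 * k + 1 + 1 by ring, Finset.sum_range_succ, Finset.sum_range_succ]
      ring

theorem isLiftable_signedConj (cs : CoxeterSystem M W) : M.IsLiftable cs.signedConj := by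
  intro i j
  ext1 ⟨t, e⟩
  rw [signedConj_mul_pow_apply, cs.simple_mul_simple_pow, two_mul, Finset.sum_range_add]
  simp only [pow_add, cs.simple_mul_simple_pow, one_mul]
  rw [CharTwo.add_self_eq_zero]
  simp

/-- The action of `W` on `W × ZMod 2` extending `signedConj`. -/
noncomputable def signedConjHom (cs : CoxeterSystem M W) : W →* Equiv.Perm (W × ZMod 2) :=
  cs.lift ⟨cs.signedConj, cs.isLiftable_signedConj⟩

theorem signedConjHom_simple (cs : CoxeterSystem M W) (i : B) :
    cs.signedConjHom (cs.simple i) = cs.signedConj i :=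
  cs.lift_apply_simple cs.isLiftable_signedConj i

theorem signedConjHom_wordProd_apply (cs : CoxeterSystem M W) (l : List B) (t : W) (e : ZMod 2) :
    cs.signedConjHom (cs.wordProd l) (t, e) =
      (cs.wordProd l * t * (cs.wordProd l)⁻¹, e + ((cs.rightInvSeq l).count t : ZMod 2)) := by
  induction l with
  | nil => simp
  | cons i l ih =>
    rw [cs.wordProd_cons, map_mul, Equiv.Perm.mul_apply, ih, signedConjHom_simple,
      signedConj_apply]
    have h : cs.wordProd l * t * (cs.wordProd l)⁻¹ = cs.simple i ↔
        (cs.wordProd l)⁻¹ * cs.simple i * cs.wordProd l = t := by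
      rw [mul_inv_eq_iff_eq_mul, ← eq_inv_mul_iff_mul_eq, ← mul_assoc, eq_comm]
    ext1
    · simp [mul_assoc]
    · simp only [h, rightInvSeq, List.count_cons, beq_iff_eq]
      split_ifs <;> simp [add_assoc]

theorem length_mul_simple_lt_of_signedConjHom (cs : CoxeterSystem M W) (x : W) (i : B)
    (h : (cs.signedConjHom x (cs.simple i, 0)).2 = 1) :
    cs.length (x * cs.simple i) < cs.length x := by
  obtain ⟨l, hl, rfl⟩ := cs.exists_isReduced x
  rw [signedConjHom_wordProd_apply] at h
  refine (cs.isRightInversion_of_mem_rightInvSeq hl ?_).2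
  by_contra hn
  simp [List.count_eq_zero_of_not_mem hn] at h

theorem signedConjHom_snd_eq_one_iff (cs : CoxeterSystem M W) (x : W) (i : B) :
    (cs.signedConjHom x (cs.simple i, 0)).2 = 1 ↔
      cs.length (x * cs.simple i) < cs.length x := by
  refine ⟨cs.length_mul_simple_lt_of_signedConjHom x i, fun h => ?_⟩
  by_contra hn
  have h0 : (cs.signedConjHom x (cs.simple i, 0)).2 = 0 := by
    generalize (cs.signedConjHom x (cs.simple i, 0)).2 = a at hn
    revert a; decide
  have key : (cs.signedConjHom (x * cs.simple i) (cs.simple i, 0)).2 = 1 := by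
    obtain ⟨l, -, rfl⟩ := cs.exists_isReduced x
    rw [signedConjHom_wordProd_apply] at h0
    rw [map_mul, Equiv.Perm.mul_apply, signedConjHom_simple, signedConj_apply]
    simp only [if_true, cs.simple_mul_simple_self, one_mul]
    rw [signedConjHom_wordProd_apply]
    simp only [zero_add] at h0 ⊢
    rw [h0, add_zero]
  have := cs.length_mul_simple_lt_of_signedConjHom _ _ key
  rw [cs.simple_mul_simple_cancel_right] at this
  omega

/-- The exchange property across one wall: if `x` and `x * s_j` lie on different sides of the
wall of `s_i`, then that wall is the one separating them. -/
theorem simple_mul_eq_mul_simple (cs : CoxeterSystem M W) (x : W) (i j : B)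
    (h₁ : cs.length x < cs.length (cs.simple i * x))
    (h₂ : cs.length (cs.simple i * (x * cs.simple j)) < cs.length (x * cs.simple j)) :
    cs.simple i * x = x * cs.simple j := by
  have e₁ : ¬ (cs.signedConjHom x⁻¹ (cs.simple i, 0)).2 = 1 := by
    rw [signedConjHom_snd_eq_one_iff, ← cs.length_inv (x⁻¹ * _), cs.length_inv x]
    simp only [mul_inv_rev, cs.inv_simple, inv_inv]
    omega
  have e₂ : (cs.signedConjHom (cs.simple j * x⁻¹) (cs.simple i, 0)).2 = 1 := by
    rw [signedConjHom_snd_eq_one_iff, ← cs.length_inv (_ * _ * _), ← cs.length_inv (_ * x⁻¹)]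
    simpa only [mul_inv_rev, cs.inv_simple, inv_inv] using h₂
  obtain ⟨l, -, hl⟩ := cs.exists_isReduced x⁻¹
  rw [map_mul, Equiv.Perm.mul_apply, hl, signedConjHom_wordProd_apply, signedConjHom_simple,
    signedConj_apply, ← hl] at e₂
  rw [hl, signedConjHom_wordProd_apply] at e₁
  by_contra hn
  rw [if_neg, add_zero] at e₂
  · exact e₁ e₂
  · intro h
    apply hn
    rw [inv_inv, mul_assoc, inv_mul_eq_iff_eq_mul] at h
    exact h

end CoxeterSystem

theorem mem_Hm_iff_not_mem_Hp (cs : CoxeterSystem M W) (i : B) (g : W) :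
    g ∈ Hm cs i ↔ g ∉ Hp cs i := by
  have := cs.length_simple_mul_ne g i
  simp only [Hm, Hp, Set.mem_ofPred_eq]
  omega

theorem Hm_eq_compl_Hp (cs : CoxeterSystem M W) (i : B) : Hm cs i = (Hp cs i)ᶜ :=
  Set.ext fun g => mem_Hm_iff_not_mem_Hp cs i g

theorem simple_mul_mem_Hm_iff (cs : CoxeterSystem M W) (i : B) (g : W) :
    cs.simple i * g ∈ Hm cs i ↔ g ∈ Hp cs i := by
  simp [Hm, Hp]

theorem one_mem_Hp (cs : CoxeterSystem M W) (i : B) : (1 : W) ∈ Hp cs i := by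
  simp [Hp]

theorem simple_mem_Hm (cs : CoxeterSystem M W) (i : B) : cs.simple i ∈ Hm cs i := by
  simp [Hm]

theorem simple_mul_eq_mul_simple_of_mem (cs : CoxeterSystem M W) {i j : B} {x : W}
    (h₁ : x ∈ Hp cs i) (h₂ : x * cs.simple j ∈ Hm cs i) :
    cs.simple i * x = x * cs.simple j :=
  cs.simple_mul_eq_mul_simple x i j h₁ h₂

theorem mem_Hm_of_smul_ssubset (cs : CoxeterSystem M W) {u : B} {w : W} {A : Set W}
    (hA : A = Hp cs u ∨ A = Hm cs u) (h : w • A ⊂ Hm cs u) : w ∈ Hm cs u := by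
  rcases hA with rfl | rfl
  · simpa using h.1 (Set.smul_mem_smul_set (a := w) (one_mem_Hp cs u))
  · by_contra hw
    rw [mem_Hm_iff_not_mem_Hp, not_not] at hw
    have hc := simple_mul_eq_mul_simple_of_mem cs hw
      (h.1 (Set.smul_mem_smul_set (a := w) (simple_mem_Hm cs u)))
    obtain ⟨z, hz, hzw⟩ := Set.exists_of_ssubset h
    rw [Set.mem_smul_set_iff_inv_smul_mem, smul_eq_mul, mem_Hm_iff_not_mem_Hp, not_not,
      ← simple_mul_mem_Hm_iff] at hzw
    have := h.1 (Set.smul_mem_smul_set (a := w) hzw)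
    rw [smul_eq_mul, ← mul_assoc, ← hc, mul_assoc, mul_inv_cancel_left,
      simple_mul_mem_Hm_iff] at this
    exact (mem_Hm_iff_not_mem_Hp cs u z).1 hz this

theorem mem_Hp_of_ssubset_smul (cs : CoxeterSystem M W) {u : B} {w : W} {A : Set W}
    (hA : A = Hp cs u ∨ A = Hm cs u) (h : Hm cs u ⊂ w • A) : w ∈ Hp cs u := by
  by_contra hw
  rw [← mem_Hm_iff_not_mem_Hp] at hw
  rcases hA with rfl | rfl
  · have hwu : w * cs.simple u ∈ Hp cs u := by
      by_contra hn
      rw [← mem_Hm_iff_not_mem_Hp] at hn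
      have := h.1 hn
      rw [Set.mem_smul_set_iff_inv_smul_mem, smul_eq_mul, inv_mul_cancel_left] at this
      exact (mem_Hm_iff_not_mem_Hp cs u _).1 (simple_mem_Hm cs u) this
    have hc := simple_mul_eq_mul_simple_of_mem cs (j := u) hwu (by simpa using hw)
    rw [← mul_assoc, mul_left_inj] at hc
    obtain ⟨z, hz, hzm⟩ := Set.exists_of_ssubset h
    rw [mem_Hm_iff_not_mem_Hp, not_not, ← simple_mul_mem_Hm_iff] at hzm
    have := h.1 hzm
    rw [Set.mem_smul_set_iff_inv_smul_mem, smul_eq_mul] at this hz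
    have e : w⁻¹ * (cs.simple u * z) = cs.simple u * (w⁻¹ * z) := by
      rw [inv_mul_eq_iff_eq_mul, ← mul_assoc w, ← hc]
      simp [mul_assoc]
    rw [e] at this
    exact (mem_Hm_iff_not_mem_Hp cs u _).1 ((simple_mul_mem_Hm_iff cs u _).2 hz) this
  · have := h.1 hw
    rw [Set.mem_smul_set_iff_inv_smul_mem, smul_eq_mul, inv_mul_cancel] at this
    exact (mem_Hm_iff_not_mem_Hp cs u _).1 this (one_mem_Hp cs u)

/-- A gallery inside `H_u^+` from `1` to `g` crossing the wall of the reflection `v s_i v⁻¹`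
contains a chamber whose mirror image also lies in `H_u^+`. -/
theorem exists_mem_Hp_conj_mul_mem_Hp (cs : CoxeterSystem M W) (u i : B) (v g : W)
    (hg : g ∈ Hp cs u) (hv : v⁻¹ ∈ Hp cs i) (hvg : v⁻¹ * g ∈ Hm cs i) :
    ∃ y ∈ Hp cs u, v * cs.simple i * v⁻¹ * y ∈ Hp cs u := by
  induction hn : cs.length g using Nat.strong_induction_on generalizing g with
  | _ n ih =>
    have hg1 : g ≠ 1 := by
      rintro rfl
      rw [mul_one] at hvg
      exact (mem_Hm_iff_not_mem_Hp cs i _).1 hvg hv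
    obtain ⟨j, hj⟩ := cs.exists_rightDescent_of_ne_one hg1
    have hj' := cs.isRightDescent_iff.1 hj
    have hgj : g * cs.simple j ∈ Hp cs u := by
      have h1 := cs.length_mul_simple (cs.simple u * g) j
      have h2 := cs.length_simple_mul_ne (g * cs.simple j) u
      simp only [Hp, Set.mem_ofPred_eq] at hg ⊢
      rw [mul_assoc] at h1
      omega
    by_cases hs : v⁻¹ * (g * cs.simple j) ∈ Hp cs i
    · refine ⟨_, hgj, ?_⟩
      have hc := simple_mul_eq_mul_simple_of_mem cs (j := j) hs (by simpa [mul_assoc] using hvg)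
      rw [mul_assoc, mul_assoc, hc]
      simpa [mul_assoc] using hg
    · exact ih _ (by omega) _ hgj ((mem_Hm_iff_not_mem_Hp cs i _).2 hs) rfl

/-- Under the nested condition, an involution mapping some element of each of the two roots
into the same root stabilizes the positive root. -/
theorem Nested.mem_StabHp_of_crossing {cs : CoxeterSystem M W} {u : B} (hnest : Nested cs u)
    {r x y : W} (hr : r * r = 1) (hy : y ∈ Hp cs u) (hry : r * y ∈ Hp cs u)
    (hx : x ∈ Hm cs u) (hrx : r * x ∈ Hm cs u) : r ∈ StabHp cs u := by
  have not_ssubset (H : Set W) : ¬ r • H ⊂ H := fun h => by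
    have := Set.smul_set_mono (a := r) h.1
    rw [smul_smul, hr, one_smul] at this
    exact h.2 this
  have mem {H K : Set W} (h : r • H ⊆ K) {z : W} (hz : z ∈ H) : r * z ∈ K :=
    h (Set.smul_mem_smul_set hz)
  have hd := mem_Hm_iff_not_mem_Hp cs u
  rcases hnest r with h | h | h | h | h | h
  · exact h
  · exact absurd hry ((hd _).1 (mem h.subset hy))
  · exact absurd h (not_ssubset _)
  · exact absurd hry ((hd _).1 (mem h.1 hy))
  · exact absurd (mem h.1 hx) ((hd _).1 hrx)
  · exact absurd h (not_ssubset _)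

/-- If, seen from `φ 1`, the chamber `φ w` lies in the negative root and `E` lies in the positive
root, then the distance from `φ w` to `E` is the apartment distance up to the stabilizer of the
root. -/
theorem Nested.exists_dist_eq_inv_mul_mul {cs : CoxeterSystem M W} {u : B} (hnest : Nested cs u)
    {Δ : Type*} {d : Δ → Δ → W} (hb : IsBuilding cs Δ d) {φ : W → Δ} (hφ : IsIsom d φ)
    {E : Δ} (hE : d (φ 1) E ∈ Hp cs u) (w : W) (hw : w ∈ Hm cs u) :
    ∃ t ∈ StabHp cs u, d (φ w) E = w⁻¹ * t * d (φ 1) E := by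
  obtain ⟨-, -, hB2, -⟩ := hb
  induction hn : cs.length w using Nat.strong_induction_on generalizing w with
  | _ n ih =>
    by_cases hwu : cs.simple u * w = 1
    · have hw' : w = cs.simple u := by
        rw [← cs.inv_simple]; exact eq_inv_of_mul_eq_one_right hwu
      subst hw'
      refine ⟨1, by simp [StabHp], ?_⟩
      rw [(hB2 (φ 1) E (φ (cs.simple u)) u (by rw [hφ]; simp)).2 hE]
      simp
    · obtain ⟨i, hi⟩ := cs.exists_rightDescent_of_ne_one hwu
      set v := w * cs.simple i with hv
      have hi' := cs.isRightDescent_iff.1 hi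
      have h1 := cs.length_mul_simple w i
      have h2 := cs.length_simple_mul v u
      have h3 := cs.length_simple_mul w u
      rw [mul_assoc, ← hv] at hi'
      rw [← hv] at h1
      have hw' : cs.length (cs.simple u * w) < cs.length w := hw
      have hvm : v ∈ Hm cs u := show cs.length (cs.simple u * v) < cs.length v by omega
      have hwv : w = v * cs.simple i := by simp [hv]
      obtain ⟨t, ht, htv⟩ := ih (cs.length v) (by omega) v hvm rfl
      have hd : d (φ w) (φ v) = cs.simple i := by rw [hφ, hv]; simp
      obtain ⟨hor, hlong⟩ := hB2 (φ v) E (φ w) i hd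
      rcases em (d (φ w) E = cs.simple i * d (φ v) E) with h | h
      · exact ⟨t, ht, by rw [h, htv, hwv]; simp [mul_assoc]⟩
      · have heq := hor.resolve_left h
        have hneg : d (φ v) E ∈ Hm cs i :=
          (mem_Hm_iff_not_mem_Hp cs i _).2 fun hp => h (hlong hp)
        have htE : t * d (φ 1) E ∈ Hp cs u := by
          have := Set.smul_mem_smul_set (a := t) hE
          rwa [show t • Hp cs u = Hp cs u from ht] at this
        have hvi : v⁻¹ ∈ Hp cs i := by
          have e : cs.simple i * v⁻¹ = w⁻¹ := by rw [hwv]; simp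
          show cs.length v⁻¹ < cs.length (cs.simple i * v⁻¹)
          rw [e, cs.length_inv, cs.length_inv]
          omega
        obtain ⟨y, hy, hry⟩ := exists_mem_Hp_conj_mul_mem_Hp cs u i v _ htE hvi
          (by rwa [← mul_assoc, ← htv])
        have hr := hnest.mem_StabHp_of_crossing (by simp [mul_assoc]) hy hry hvm
          (by rw [inv_mul_cancel_right, ← hwv]; exact hw)
        refine ⟨v * cs.simple i * v⁻¹ * t, ?_, ?_⟩
        · show _ • Hp cs u = Hp cs u
          rw [mul_smul, show t • Hp cs u = Hp cs u from ht]
          exact hr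
        · rw [heq, htv, hwv]
          simp [mul_assoc]

/-- Transitivity of root inclusions in a building satisfying the nested condition, case (ii). -/
theorem root_inclusion_transitivity_neg (cs : CoxeterSystem M W) (u : B) (hnest : Nested cs u)
    {Δ : Type*} (d : Δ → Δ → W) (hb : IsBuilding cs Δ d)
    (φ φ₁ φ₂ : W → Δ) (hφ : IsIsom d φ) (hφ₁ : IsIsom d φ₁) (hφ₂ : IsIsom d φ₂)
    (C D E : Δ) (w w₁ w₂ : W)
    (hD : φ 1 = D) (hD₁ : φ₁ 1 = D) (hC : φ w = C) (hE₁ : φ₁ w₁ = E)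
    (hC₂ : φ₂ 1 = C) (hE₂ : φ₂ w₂ = E)
    (A A' : Set W) (hA : A = Hp cs u ∨ A = Hm cs u) (hA' : A' = Hp cs u ∨ A' = Hm cs u)
    (h₁ : w • A ⊂ Hm cs u) (h₂ : Hm cs u ⊂ w₁ • A') :
    A ⊂ w₂ • A' := by
  have hw := mem_Hm_of_smul_ssubset cs hA h₁
  have hw₁ := mem_Hp_of_ssubset_smul cs hA' h₂
  have hDE : d (φ 1) E = w₁ := by rw [hD, ← hD₁, ← hE₁, hφ₁]; simp
  have hCE : d (φ w) E = w₂ := by rw [hC, ← hC₂, ← hE₂, hφ₂]; simp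
  obtain ⟨t, ht, h⟩ := hnest.exists_dist_eq_inv_mul_mul hb hφ (hDE ▸ hw₁) w hw
  rw [hCE, hDE] at h
  have htm : t • Hm cs u = Hm cs u := by
    rw [Hm_eq_compl_Hp, Set.smul_set_compl, show t • Hp cs u = Hp cs u from ht]
  have hA₁ : A ⊂ w⁻¹ • Hm cs u := by
    rw [ssubset_iff_subset_not_subset] at h₁ ⊢
    rwa [← Set.smul_set_subset_iff_subset_inv_smul_set, ← Set.subset_smul_set_iff]
  have hA₂ : w⁻¹ • Hm cs u ⊆ w₂ • A' := by
    rw [h, mul_smul, mul_smul]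
    refine Set.smul_set_mono ?_
    rw [← htm]
    exact Set.smul_set_mono h₂.1
  exact hA₁.trans_subset hA₂
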